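/- Let m ≥ 1 be an integer. There exists a constant c > 0, depending only on m, such that for all smooth periodic functions v, w : ℝ² → ℝ, ‖A^{m−1}(∇v · ∇w)‖ ≤ c ‖A^m v‖ ‖A^m w‖, where ∇v · ∇w = (∂ₓv)(∂ₓw) + (∂ᵧv)(∂ᵧw). -/

import Mathlib

open MeasureTheory Real Filter

noncomputable section

/-- A function `u : ℝ² → ℝ` is smooth periodic if it is `C^∞` and `2π`-periodic
in each variable. -/
def SmoothPeriodic (u : ℝ × ℝ → ℝ) : Prop :=
  ContDiff ℝ (⊤ : ℕ∞) u ∧ (∀ x y, u (x + 2 * Real.pi, y) = u (x, y)) ∧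
    (∀ x y, u (x, y + 2 * Real.pi) = u (x, y))

/-- Partial derivative in the first variable. -/
def pdx (u : ℝ × ℝ → ℝ) : ℝ × ℝ → ℝ := fun p => fderiv ℝ u p (1, 0)

/-- Partial derivative in the second variable. -/
def pdy (u : ℝ × ℝ → ℝ) : ℝ × ℝ → ℝ := fun p => fderiv ℝ u p (0, 1)

/-- The fundamental domain `[0, 2π]²`. -/
def sq2 : Set (ℝ × ℝ) := Set.Icc (0 : ℝ) (2 * Real.pi) ×ˢ Set.Icc (0 : ℝ) (2 * Real.pi)

/-- The `L²` inner product over `[0, 2π]²`. -/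
def l2inner (u v : ℝ × ℝ → ℝ) : ℝ := ∫ p in sq2, u p * v p

/-- The `L²` norm over `[0, 2π]²`. -/
def l2norm (u : ℝ × ℝ → ℝ) : ℝ := Real.sqrt (∫ p in sq2, (u p) ^ 2)

/-- The `L^q` norm over `[0, 2π]²`. -/
def lpnorm (q : ℝ) (u : ℝ × ℝ → ℝ) : ℝ := (∫ p in sq2, |u p| ^ q) ^ (1 / q)

/-- The operator `A = -Δ + 1`. -/
def Aop (u : ℝ × ℝ → ℝ) : ℝ × ℝ → ℝ :=
  fun p => -(pdx (pdx u) p + pdy (pdy u) p) + u p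

/-- The pointwise dot product of gradients, `∇v ⋅ ∇w`. -/
def gradDot (v w : ℝ × ℝ → ℝ) : ℝ × ℝ → ℝ :=
  fun p => pdx v p * pdx w p + pdy v p * pdy w p

/-- The nonlinearity `f(u) = (a+3)u − 4Au + b|∇u|² + u³`. -/
def fNL (a b : ℝ) (u : ℝ × ℝ → ℝ) : ℝ × ℝ → ℝ :=
  fun p => (a + 3) * u p - 4 * Aop u p + b * gradDot u u p + (u p) ^ 3

/-! ### Smooth periodic functions -/

namespace SmoothPeriodic

variable {u v : ℝ × ℝ → ℝ}

theorem differentiable (hu : SmoothPeriodic u) : Differentiable ℝ u :=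
  hu.1.differentiable (by simp)

theorem continuous (hu : SmoothPeriodic u) : Continuous u := hu.1.continuous

theorem contDiff_fderiv_apply (hu : SmoothPeriodic u) (e : ℝ × ℝ) :
    ContDiff ℝ (⊤ : ℕ∞) (fun p => fderiv ℝ u p e) :=
  (hu.1.fderiv_right (m := (⊤ : ℕ∞)) (by simp)).clm_apply contDiff_const

theorem fderiv_periodic {c : ℝ × ℝ} (h : ∀ p, u (p + c) = u p) (p : ℝ × ℝ) :
    fderiv ℝ u (p + c) = fderiv ℝ u p := by
  rw [← fderiv_comp_add_right c]
  exact congrArg (fun f => fderiv ℝ f p) (funext h)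

theorem fderiv_apply (hu : SmoothPeriodic u) (e : ℝ × ℝ) :
    SmoothPeriodic (fun p => fderiv ℝ u p e) := by
  refine ⟨hu.contDiff_fderiv_apply e, fun x y => ?_, fun x y => ?_⟩
  · have := fderiv_periodic (u := u) (c := (2 * π, 0))
      (fun p => by simpa [Prod.add_def] using hu.2.1 p.1 p.2) (x, y)
    simp only [Prod.mk_add_mk, add_zero] at this
    simp only [this]
  · have := fderiv_periodic (u := u) (c := (0, 2 * π))
      (fun p => by simpa [Prod.add_def] using hu.2.2 p.1 p.2) (x, y)
    simp only [Prod.mk_add_mk, add_zero] at this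
    simp only [this]

theorem pdx (hu : SmoothPeriodic u) : SmoothPeriodic (pdx u) := hu.fderiv_apply _

theorem pdy (hu : SmoothPeriodic u) : SmoothPeriodic (pdy u) := hu.fderiv_apply _

theorem add (hu : SmoothPeriodic u) (hv : SmoothPeriodic v) : SmoothPeriodic (u + v) :=
  ⟨hu.1.add hv.1, fun x y => by simp [hu.2.1, hv.2.1], fun x y => by simp [hu.2.2, hv.2.2]⟩

theorem mul (hu : SmoothPeriodic u) (hv : SmoothPeriodic v) : SmoothPeriodic (u * v) :=
  ⟨hu.1.mul hv.1, fun x y => by simp [hu.2.1, hv.2.1], fun x y => by simp [hu.2.2, hv.2.2]⟩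

theorem neg (hu : SmoothPeriodic u) : SmoothPeriodic (-u) :=
  ⟨hu.1.neg, fun x y => by simp [hu.2.1], fun x y => by simp [hu.2.2]⟩

theorem Aop (hu : SmoothPeriodic u) : SmoothPeriodic (Aop u) :=
  (hu.pdx.pdx.add hu.pdy.pdy).neg.add hu

end SmoothPeriodic

/-! ### Calculus of the partial derivatives -/

theorem pdx_add {u v : ℝ × ℝ → ℝ} (hu : SmoothPeriodic u) (hv : SmoothPeriodic v) :
    pdx (u + v) = pdx u + pdx v := by
  ext p
  simp [pdx, fderiv_add (hu.differentiable p) (hv.differentiable p)]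

theorem pdy_add {u v : ℝ × ℝ → ℝ} (hu : SmoothPeriodic u) (hv : SmoothPeriodic v) :
    pdy (u + v) = pdy u + pdy v := by
  ext p
  simp [pdy, fderiv_add (hu.differentiable p) (hv.differentiable p)]

theorem pdx_neg (u : ℝ × ℝ → ℝ) : pdx (-u) = -pdx u := by
  ext p
  simp [pdx, fderiv_neg]

theorem pdy_neg (u : ℝ × ℝ → ℝ) : pdy (-u) = -pdy u := by
  ext p
  simp [pdy, fderiv_neg]

theorem pdx_mul {u v : ℝ × ℝ → ℝ} (hu : SmoothPeriodic u) (hv : SmoothPeriodic v) :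
    pdx (u * v) = pdx u * v + u * pdx v := by
  ext p
  simp [pdx, fderiv_mul (hu.differentiable p) (hv.differentiable p)]
  ring

theorem pdy_mul {u v : ℝ × ℝ → ℝ} (hu : SmoothPeriodic u) (hv : SmoothPeriodic v) :
    pdy (u * v) = pdy u * v + u * pdy v := by
  ext p
  simp [pdy, fderiv_mul (hu.differentiable p) (hv.differentiable p)]
  ring

theorem pdy_pdx {u : ℝ × ℝ → ℝ} (hu : SmoothPeriodic u) : pdy (pdx u) = pdx (pdy u) := by
  ext p
  have hd : DifferentiableAt ℝ (fderiv ℝ u) p :=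
    (hu.1.fderiv_right (m := (⊤ : ℕ∞)) (by simp)).differentiable (by simp) p
  have hs : IsSymmSndFDerivAt ℝ u p := by
    refine hu.1.contDiffAt.isSymmSndFDerivAt ?_
    rw [minSmoothness_of_isRCLikeNormedField]
    exact WithTop.coe_le_coe.2 le_top
  have key : ∀ a b : ℝ × ℝ,
      fderiv ℝ (fun q => fderiv ℝ u q a) p b = fderiv ℝ (fderiv ℝ u) p b a := by
    intro a b
    rw [fderiv_clm_apply hd (differentiableAt_const a)]
    simp
  calc pdy (pdx u) p = fderiv ℝ (fderiv ℝ u) p (0, 1) (1, 0) := key _ _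
    _ = fderiv ℝ (fderiv ℝ u) p (1, 0) (0, 1) := hs.eq _ _
    _ = pdx (pdy u) p := (key _ _).symm

theorem Aop_eq (u : ℝ × ℝ → ℝ) : Aop u = -(pdx (pdx u) + pdy (pdy u)) + u := rfl

theorem Aop_add {u v : ℝ × ℝ → ℝ} (hu : SmoothPeriodic u) (hv : SmoothPeriodic v) :
    Aop (u + v) = Aop u + Aop v := by
  simp only [Aop_eq, pdx_add hu hv, pdy_add hu hv, pdx_add hu.pdx hv.pdx, pdy_add hu.pdy hv.pdy]
  ring

theorem Aop_neg (u : ℝ × ℝ → ℝ) : Aop (-u) = -Aop u := by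
  simp only [Aop_eq, pdx_neg, pdy_neg]
  ring

theorem Aop_pdx {u : ℝ × ℝ → ℝ} (hu : SmoothPeriodic u) : Aop (pdx u) = pdx (Aop u) := by
  rw [Aop_eq, Aop_eq, pdx_add (hu.pdx.pdx.add hu.pdy.pdy).neg hu, pdx_neg,
    pdx_add hu.pdx.pdx hu.pdy.pdy, pdy_pdx hu, pdy_pdx hu.pdy]

theorem Aop_pdy {u : ℝ × ℝ → ℝ} (hu : SmoothPeriodic u) : Aop (pdy u) = pdy (Aop u) := by
  rw [Aop_eq, Aop_eq, pdy_add (hu.pdx.pdx.add hu.pdy.pdy).neg hu, pdy_neg,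
    pdy_add hu.pdx.pdx hu.pdy.pdy, pdy_pdx hu.pdx, pdy_pdx hu]

theorem Aop_mul {f g : ℝ × ℝ → ℝ} (hf : SmoothPeriodic f) (hg : SmoothPeriodic g) :
    Aop (f * g) = f * g + -((pdx (pdx f) * g + f * pdx (pdx g) +
      (pdx f * pdx g + pdx f * pdx g)) + (pdy (pdy f) * g + f * pdy (pdy g) +
      (pdy f * pdy g + pdy f * pdy g))) := by
  rw [Aop_eq, pdx_mul hf hg, pdy_mul hf hg, pdx_add (hf.pdx.mul hg) (hf.mul hg.pdx),
    pdy_add (hf.pdy.mul hg) (hf.mul hg.pdy), pdx_mul hf.pdx hg, pdx_mul hf hg.pdx,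
    pdy_mul hf.pdy hg, pdy_mul hf hg.pdy]
  ring

theorem SmoothPeriodic.iterate_Aop {u : ℝ × ℝ → ℝ} (hu : SmoothPeriodic u) (k : ℕ) :
    SmoothPeriodic (_root_.Aop^[k] u) := by
  induction k generalizing u with
  | zero => exact hu
  | succ k ih => exact ih hu.Aop

theorem iterate_Aop_add (k : ℕ) {u v : ℝ × ℝ → ℝ} (hu : SmoothPeriodic u)
    (hv : SmoothPeriodic v) : Aop^[k] (u + v) = Aop^[k] u + Aop^[k] v := by
  induction k generalizing u v with
  | zero => rfl
  | succ k ih => simp only [Function.iterate_succ_apply, Aop_add hu hv, ih hu.Aop hv.Aop]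

theorem iterate_Aop_neg (k : ℕ) (u : ℝ × ℝ → ℝ) : Aop^[k] (-u) = -Aop^[k] u := by
  induction k generalizing u with
  | zero => rfl
  | succ k ih => simp only [Function.iterate_succ_apply, Aop_neg, ih]

/-! ### Integration over the square -/

/-- Lebesgue measure on `[0, 2π]`. -/
def periodMeasure : Measure ℝ := volume.restrict (Set.Icc 0 (2 * π))

instance : IsFiniteMeasure periodMeasure :=
  ⟨by simp [periodMeasure, ENNReal.mul_lt_top]⟩

theorem volume_restrict_sq2 :
    (volume : Measure (ℝ × ℝ)).restrict sq2 = periodMeasure.prod periodMeasure := by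
  rw [periodMeasure, Measure.prod_restrict]
  rfl

theorem isCompact_sq2 : IsCompact sq2 := isCompact_Icc.prod isCompact_Icc

theorem Continuous.integrable_sq2 {f : ℝ × ℝ → ℝ} (hf : Continuous f) :
    Integrable f (volume.restrict sq2) :=
  hf.continuousOn.integrableOn_compact isCompact_sq2

theorem Continuous.integrable_sq2_sq {f : ℝ × ℝ → ℝ} (hf : Continuous f) :
    Integrable (fun p => f p ^ 2) (volume.restrict sq2) :=
  (hf.pow 2).integrable_sq2

theorem Continuous.integrable_prod_periodMeasure {f : ℝ × ℝ → ℝ} (hf : Continuous f) :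
    Integrable f (periodMeasure.prod periodMeasure) :=
  volume_restrict_sq2 ▸ hf.integrable_sq2

theorem integral_periodMeasure (f : ℝ → ℝ) :
    ∫ x, f x ∂periodMeasure = ∫ x in (0 : ℝ)..2 * π, f x := by
  rw [periodMeasure, integral_Icc_eq_integral_Ioc,
    intervalIntegral.integral_of_le two_pi_pos.le]

theorem hasDerivAt_fst {u : ℝ × ℝ → ℝ} (hu : SmoothPeriodic u) (x y : ℝ) :
    HasDerivAt (fun t => u (t, y)) (pdx u (x, y)) x :=
  (hu.differentiable (x, y)).hasFDerivAt.comp_hasDerivAt x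
    ((hasDerivAt_id x).prodMk (hasDerivAt_const x y))

theorem hasDerivAt_snd {u : ℝ × ℝ → ℝ} (hu : SmoothPeriodic u) (x y : ℝ) :
    HasDerivAt (fun t => u (x, t)) (pdy u (x, y)) y :=
  (hu.differentiable (x, y)).hasFDerivAt.comp_hasDerivAt y
    ((hasDerivAt_const y x).prodMk (hasDerivAt_id y))

theorem integral_pdx {u : ℝ × ℝ → ℝ} (hu : SmoothPeriodic u) : ∫ p in sq2, pdx u p = 0 := by
  rw [volume_restrict_sq2, integral_prod_symm _ hu.pdx.continuous.integrable_prod_periodMeasure]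
  refine integral_eq_zero_of_ae (.of_forall fun y => ?_)
  simp only [Pi.zero_apply]
  rw [integral_periodMeasure, intervalIntegral.integral_eq_sub_of_hasDerivAt
    (fun x _ => hasDerivAt_fst hu x y)
    ((hu.pdx.continuous.comp (by fun_prop : Continuous fun x : ℝ => (x, y))).intervalIntegrable _ _)]
  have := hu.2.1 0 y
  rw [zero_add] at this
  rw [this, sub_self]

theorem integral_pdy {u : ℝ × ℝ → ℝ} (hu : SmoothPeriodic u) : ∫ p in sq2, pdy u p = 0 := by
  rw [volume_restrict_sq2, integral_prod _ hu.pdy.continuous.integrable_prod_periodMeasure]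
  refine integral_eq_zero_of_ae (.of_forall fun x => ?_)
  simp only [Pi.zero_apply]
  rw [integral_periodMeasure, intervalIntegral.integral_eq_sub_of_hasDerivAt
    (fun y _ => hasDerivAt_snd hu x y)
    ((hu.pdy.continuous.comp (by fun_prop : Continuous fun y : ℝ => (x, y))).intervalIntegrable _ _)]
  have := hu.2.2 x 0
  rw [zero_add] at this
  rw [this, sub_self]

/-- The squared `L²` norm over the square. -/
def l2sq (u : ℝ × ℝ → ℝ) : ℝ := ∫ p in sq2, u p ^ 2

theorem l2sq_nonneg (u : ℝ × ℝ → ℝ) : 0 ≤ l2sq u := integral_nonneg fun _ => sq_nonneg _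

theorem l2norm_eq_sqrt (u : ℝ × ℝ → ℝ) : l2norm u = √(l2sq u) := rfl

theorem l2sq_neg (u : ℝ × ℝ → ℝ) : l2sq (-u) = l2sq u := by simp [l2sq]

theorem l2sq_add_le {u v : ℝ × ℝ → ℝ} (hu : Continuous u) (hv : Continuous v) :
    l2sq (u + v) ≤ 2 * (l2sq u + l2sq v) := by
  rw [l2sq, l2sq, l2sq, ← integral_add hu.integrable_sq2_sq hv.integrable_sq2_sq,
    ← integral_const_mul]
  refine integral_mono ((hu.add hv).pow 2).integrable_sq2
    (by exact (continuous_const.mul ((hu.pow 2).add (hv.pow 2))).integrable_sq2) fun p => ?_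
  simp only [Pi.add_apply]
  nlinarith [sq_nonneg (u p - v p)]

/-! ### The elliptic estimate -/

theorem Aop_sq_eq {u : ℝ × ℝ → ℝ} (hu : SmoothPeriodic u) (p : ℝ × ℝ) :
    Aop u p ^ 2 = (u p ^ 2 + 2 * pdx u p ^ 2 + 2 * pdy u p ^ 2 + pdx (pdx u) p ^ 2 +
      2 * pdx (pdy u) p ^ 2 + pdy (pdy u) p ^ 2) +
      2 * (pdx (pdx u * pdy (pdy u) + -(u * pdx u)) p -
        pdy (pdx u * pdx (pdy u) + u * pdy u) p) := by
  have h1 : pdy (pdx (pdy u)) = pdx (pdy (pdy u)) := pdy_pdx hu.pdy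
  rw [pdx_add (hu.pdx.mul hu.pdy.pdy) (hu.mul hu.pdx).neg, pdx_neg, pdx_mul hu.pdx hu.pdy.pdy,
    pdx_mul hu hu.pdx, pdy_add (hu.pdx.mul hu.pdy.pdx) (hu.mul hu.pdy),
    pdy_mul hu.pdx hu.pdy.pdx, pdy_mul hu hu.pdy, h1, pdy_pdx hu]
  simp only [Aop, Pi.add_apply, Pi.mul_apply, Pi.neg_apply]
  ring

theorem l2sq_le_l2sq_Aop {u d : ℝ × ℝ → ℝ} (hu : SmoothPeriodic u) (hd : Continuous d)
    (h : ∀ p, d p ^ 2 ≤ u p ^ 2 + 2 * pdx u p ^ 2 + 2 * pdy u p ^ 2 + pdx (pdx u) p ^ 2 +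
      2 * pdx (pdy u) p ^ 2 + pdy (pdy u) p ^ 2) :
    l2sq d ≤ l2sq (Aop u) := by
  set h₁ := pdx u * pdy (pdy u) + -(u * pdx u) with hh₁
  set h₂ := pdx u * pdx (pdy u) + u * pdy u with hh₂
  have s₁ : SmoothPeriodic h₁ := (hu.pdx.mul hu.pdy.pdy).add (hu.mul hu.pdx).neg
  have s₂ : SmoothPeriodic h₂ := (hu.pdx.mul hu.pdy.pdx).add (hu.mul hu.pdy)
  have i₁ := s₁.pdx.continuous.integrable_sq2
  have i₂ := s₂.pdy.continuous.integrable_sq2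
  have i₁₂ : Integrable (fun p => pdx h₁ p - pdy h₂ p) (volume.restrict sq2) := i₁.sub i₂
  have iA := hu.Aop.continuous.integrable_sq2_sq
  have key : l2sq (Aop u) = ∫ p in sq2, (Aop u p ^ 2 - 2 * (pdx h₁ p - pdy h₂ p)) := by
    rw [integral_sub iA (i₁₂.const_mul 2), integral_const_mul, integral_sub i₁ i₂,
      integral_pdx s₁, integral_pdy s₂, l2sq]
    ring
  rw [key, l2sq]
  refine integral_mono (hd.pow 2).integrable_sq2 (iA.sub (i₁₂.const_mul 2)) fun p => ?_
  have := Aop_sq_eq hu p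
  rw [← hh₁, ← hh₂] at this
  simp only
  linarith [h p]

/-- All partial derivatives of `f` of order at most `n` have squared `L²` norm at most `M`. -/
def SobolevBound : ℕ → (ℝ × ℝ → ℝ) → ℝ → Prop
  | 0, f, M => l2sq f ≤ M
  | n + 1, f, M => l2sq f ≤ M ∧ SobolevBound n (pdx f) M ∧ SobolevBound n (pdy f) M

namespace SobolevBound

variable {n : ℕ} {f : ℝ × ℝ → ℝ} {M : ℝ}

theorem l2sq_le (h : SobolevBound n f M) : l2sq f ≤ M := by
  cases n with
  | zero => exact h
  | succ n => exact h.1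

theorem of_succ (h : SobolevBound (n + 1) f M) : SobolevBound n f M := by
  induction n generalizing f with
  | zero => exact h.1
  | succ n ih => exact ⟨h.1, ih h.2.1, ih h.2.2⟩

theorem of_Aop (hf : SmoothPeriodic f) (h : SobolevBound n (Aop f) M) :
    SobolevBound (n + 2) f M := by
  induction n generalizing f with
  | zero =>
    have key : ∀ d : ℝ × ℝ → ℝ, Continuous d → (∀ p, d p ^ 2 ≤ f p ^ 2 + 2 * pdx f p ^ 2 +
        2 * pdy f p ^ 2 + pdx (pdx f) p ^ 2 + 2 * pdx (pdy f) p ^ 2 + pdy (pdy f) p ^ 2) →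
        l2sq d ≤ M := fun d hd hle => (l2sq_le_l2sq_Aop hf hd hle).trans h
    refine ⟨key _ hf.continuous ?_, ⟨key _ hf.pdx.continuous ?_, key _ hf.pdx.pdx.continuous ?_,
      ?_⟩, key _ hf.pdy.continuous ?_, key _ hf.pdy.pdx.continuous ?_,
      key _ hf.pdy.pdy.continuous ?_⟩
    case refine_4 =>
      rw [pdy_pdx hf]
      refine key _ hf.pdy.pdx.continuous fun p => ?_
      nlinarith [sq_nonneg (f p), sq_nonneg (pdx f p), sq_nonneg (pdy f p),
        sq_nonneg (pdx (pdx f) p), sq_nonneg (pdx (pdy f) p), sq_nonneg (pdy (pdy f) p)]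
    all_goals
      intro p
      nlinarith [sq_nonneg (f p), sq_nonneg (pdx f p), sq_nonneg (pdy f p),
        sq_nonneg (pdx (pdx f) p), sq_nonneg (pdx (pdy f) p), sq_nonneg (pdy (pdy f) p)]
  | succ n ih =>
    have h₀ : l2sq f ≤ l2sq (Aop f) := by
      refine l2sq_le_l2sq_Aop hf hf.continuous fun p => ?_
      nlinarith [sq_nonneg (f p), sq_nonneg (pdx f p), sq_nonneg (pdy f p),
        sq_nonneg (pdx (pdx f) p), sq_nonneg (pdx (pdy f) p), sq_nonneg (pdy (pdy f) p)]
    exact ⟨h₀.trans h.1, ih hf.pdx (Aop_pdx hf ▸ h.2.1), ih hf.pdy (Aop_pdy hf ▸ h.2.2)⟩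

theorem of_iterate_Aop (m : ℕ) (hf : SmoothPeriodic f) :
    SobolevBound (2 * m) f (l2sq (_root_.Aop^[m] f)) := by
  induction m generalizing f with
  | zero => exact le_refl (l2sq f)
  | succ m ih => exact of_Aop hf (ih hf.Aop)

end SobolevBound

/-! ### The product estimate -/

theorem sq_le_integral {φ φ' : ℝ → ℝ} (hφ : ∀ t, HasDerivAt φ (φ' t) t) (hφ' : Continuous φ')
    {s : ℝ} (hs : s ∈ Set.Icc 0 (2 * π)) :
    φ s ^ 2 ≤ ∫ t, (2 * φ t ^ 2 + φ' t ^ 2) ∂periodMeasure := by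
  have hc : Continuous φ := continuous_iff_continuousAt.2 fun t => (hφ t).continuousAt
  have hpi : (0 : ℝ) ≤ 2 * π := two_pi_pos.le
  set K : ℝ := ∫ t in (0 : ℝ)..2 * π, (φ t ^ 2 + φ' t ^ 2) with hK
  have hc2 : Continuous fun t => φ t ^ 2 := hc.pow 2
  have hcK : Continuous fun t => φ t ^ 2 + φ' t ^ 2 := by fun_prop
  have hK0 : 0 ≤ K := intervalIntegral.integral_nonneg hpi fun t _ => by positivity
  have hdiff : ∀ t ∈ Set.Icc 0 (2 * π), φ s ^ 2 ≤ φ t ^ 2 + K := by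
    intro t ht
    have hF : ∀ r ∈ Set.uIcc t s, HasDerivAt (fun r => φ r ^ 2) (2 * φ r * φ' r) r := by
      intro r _
      exact ((hφ r).fun_pow 2).congr_deriv (by simp)
    have hint : φ s ^ 2 - φ t ^ 2 = ∫ r in t..s, 2 * φ r * φ' r :=
      (intervalIntegral.integral_eq_sub_of_hasDerivAt hF
        ((by fun_prop : Continuous fun r => 2 * φ r * φ' r).intervalIntegrable _ _)).symm
    have hb : |∫ r in t..s, 2 * φ r * φ' r| ≤ K := by
      have h₁ : |∫ r in t..s, 2 * φ r * φ' r| ≤ |∫ r in t..s, (φ r ^ 2 + φ' r ^ 2)| := by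
        refine intervalIntegral.norm_integral_le_abs_of_norm_le (μ := volume)
          (f := fun r => 2 * φ r * φ' r) (.of_forall fun r => ?_)
          (hcK.intervalIntegrable _ _)
        rw [Real.norm_eq_abs, abs_le]
        constructor <;> nlinarith [sq_nonneg (φ r - φ' r), sq_nonneg (φ r + φ' r)]
      refine h₁.trans ?_
      have h₂ := intervalIntegral.abs_integral_mono_interval (μ := volume) (a := t) (b := s)
        (c := 0) (d := 2 * π) (f := fun r => φ r ^ 2 + φ' r ^ 2) ?_ (.of_forall fun r => ?_)
        (hcK.intervalIntegrable _ _)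
      · rwa [abs_of_nonneg (a := ∫ r in (0 : ℝ)..2 * π, (φ r ^ 2 + φ' r ^ 2)) hK0] at h₂
      · rw [Set.uIoc_of_le hpi]
        exact Set.Ioc_subset_Ioc (le_min ht.1 hs.1) (max_le ht.2 hs.2)
      · simp only [Pi.zero_apply]
        positivity
    linarith [le_abs_self (∫ r in t..s, 2 * φ r * φ' r)]
  have havg : 2 * π * φ s ^ 2 ≤ (∫ t in (0 : ℝ)..2 * π, φ t ^ 2) + 2 * π * K := by
    have := intervalIntegral.integral_mono_on (μ := volume) hpi
      (continuous_const.intervalIntegrable (μ := volume) 0 (2 * π))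
      ((by fun_prop : Continuous fun t => φ t ^ 2 + K).intervalIntegrable 0 (2 * π)) hdiff
    rw [intervalIntegral.integral_add (hc2.intervalIntegrable _ _)
      (continuous_const.intervalIntegrable _ _)] at this
    simpa using this
  have hφ0 : 0 ≤ ∫ t in (0 : ℝ)..2 * π, φ t ^ 2 :=
    intervalIntegral.integral_nonneg hpi fun t _ => sq_nonneg _
  have hsplit : ∫ t in (0 : ℝ)..2 * π, (2 * φ t ^ 2 + φ' t ^ 2) =
      (∫ t in (0 : ℝ)..2 * π, φ t ^ 2) + K := by
    rw [hK, ← intervalIntegral.integral_add (hc2.intervalIntegrable _ _)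
      (hcK.intervalIntegrable _ _)]
    exact intervalIntegral.integral_congr fun t _ => by ring
  rw [integral_periodMeasure, hsplit]
  have h1 : 1 ≤ 2 * π := by linarith [pi_gt_three]
  by_contra! hcon
  nlinarith

theorem l2sq_mul_le {f g : ℝ × ℝ → ℝ} (hf : SmoothPeriodic f) (hg : SmoothPeriodic g) :
    l2sq (f * g) ≤ (2 * l2sq f + l2sq (pdy f)) * (2 * l2sq g + l2sq (pdx g)) := by
  have cf := hf.continuous
  have cg := hg.continuous
  have cf' := hf.pdy.continuous
  have cg' := hg.pdx.continuous
  have iF : Integrable (fun p => 2 * f p ^ 2 + pdy f p ^ 2) (periodMeasure.prod periodMeasure) :=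
    (by fun_prop : Continuous fun p => 2 * f p ^ 2 + pdy f p ^ 2).integrable_prod_periodMeasure
  have iG : Integrable (fun p => 2 * g p ^ 2 + pdx g p ^ 2) (periodMeasure.prod periodMeasure) :=
    (by fun_prop : Continuous fun p => 2 * g p ^ 2 + pdx g p ^ 2).integrable_prod_periodMeasure
  have split : ∀ a b : ℝ × ℝ → ℝ, Continuous a → Continuous b →
      2 * l2sq a + l2sq b = ∫ p, (2 * a p ^ 2 + b p ^ 2) ∂(periodMeasure.prod periodMeasure) := by
    intro a b ha hb
    rw [← volume_restrict_sq2, integral_add (ha.integrable_sq2_sq.const_mul 2)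
      hb.integrable_sq2_sq, integral_const_mul]
    rfl
  rw [split f _ cf cf', split g _ cg cg', integral_prod _ iF, integral_prod_symm _ iG,
    ← integral_prod_mul, l2sq, volume_restrict_sq2]
  refine integral_mono_ae ((cf.mul cg).pow 2).integrable_prod_periodMeasure
    (iF.integral_prod_left.mul_prod iG.integral_prod_right) ?_
  have hmem : ∀ᵐ p ∂(periodMeasure.prod periodMeasure), p ∈ sq2 := by
    rw [← volume_restrict_sq2]
    exact ae_restrict_mem (measurableSet_Icc.prod measurableSet_Icc)
  filter_upwards [hmem] with p hp
  simp only [Pi.mul_apply, mul_pow]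
  refine mul_le_mul ?_ ?_ (sq_nonneg _) (integral_nonneg fun t => by positivity)
  · exact sq_le_integral (fun t => hasDerivAt_snd hf p.1 t)
      (cf'.comp (by fun_prop : Continuous fun t : ℝ => (p.1, t))) hp.2
  · exact sq_le_integral (fun t => hasDerivAt_fst hg t p.2)
      (cg'.comp (by fun_prop : Continuous fun t : ℝ => (t, p.2))) hp.1

theorem l2sq_iterate_Aop_add_le (k : ℕ) {u v : ℝ × ℝ → ℝ} (hu : SmoothPeriodic u)
    (hv : SmoothPeriodic v) {B C : ℝ} (hB : l2sq (Aop^[k] u) ≤ B) (hC : l2sq (Aop^[k] v) ≤ C) :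
    l2sq (Aop^[k] (u + v)) ≤ 2 * (B + C) := by
  rw [iterate_Aop_add k hu hv]
  linarith [l2sq_add_le (hu.iterate_Aop k).continuous (hv.iterate_Aop k).continuous]

theorem exists_l2sq_iterate_Aop_mul_le (k : ℕ) :
    ∃ C > 0, ∀ (f g : ℝ × ℝ → ℝ) (M N : ℝ), SmoothPeriodic f → SmoothPeriodic g →
      SobolevBound (2 * k + 1) f M → SobolevBound (2 * k + 1) g N →
      l2sq (Aop^[k] (f * g)) ≤ C * (M * N) := by
  induction k with
  | zero =>
    refine ⟨9, by norm_num, fun f g M N hf hg hM hN => ?_⟩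
    have hM₁ : l2sq f ≤ M := hM.1
    have hM₂ : l2sq (pdy f) ≤ M := hM.2.2
    have hN₁ : l2sq g ≤ N := hN.1
    have hN₂ : l2sq (pdx g) ≤ N := hN.2.1
    calc l2sq (f * g) ≤ (2 * l2sq f + l2sq (pdy f)) * (2 * l2sq g + l2sq (pdx g)) :=
          l2sq_mul_le hf hg
      _ ≤ (3 * M) * (3 * N) := by
          refine mul_le_mul (by linarith) (by linarith) ?_ ?_
          · linarith [l2sq_nonneg g, l2sq_nonneg (pdx g)]
          · linarith [l2sq_nonneg f]
      _ = 9 * (M * N) := by ring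
  | succ k ih =>
    obtain ⟨C, hC, ih⟩ := ih
    refine ⟨130 * C, by positivity, fun f g M N hf hg hM hN => ?_⟩
    have hM₁ := hM.2.1.of_succ
    have hM₂ := hM.2.2.of_succ
    have hN₁ := hN.2.1.of_succ
    have hN₂ := hN.2.2.of_succ
    have hM₀ := hM.of_succ.of_succ
    have hN₀ := hN.of_succ.of_succ
    have e₀ := ih f g M N hf hg hM₀ hN₀
    have ex := l2sq_iterate_Aop_add_le k ((hf.pdx.pdx.mul hg).add (hf.mul hg.pdx.pdx))
      ((hf.pdx.mul hg.pdx).add (hf.pdx.mul hg.pdx))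
      (l2sq_iterate_Aop_add_le k (hf.pdx.pdx.mul hg) (hf.mul hg.pdx.pdx)
        (ih _ _ M N hf.pdx.pdx hg hM.2.1.2.1 hN₀) (ih _ _ M N hf hg.pdx.pdx hM₀ hN.2.1.2.1))
      (l2sq_iterate_Aop_add_le k (hf.pdx.mul hg.pdx) (hf.pdx.mul hg.pdx)
        (ih _ _ M N hf.pdx hg.pdx hM₁ hN₁) (ih _ _ M N hf.pdx hg.pdx hM₁ hN₁))
    have ey := l2sq_iterate_Aop_add_le k ((hf.pdy.pdy.mul hg).add (hf.mul hg.pdy.pdy))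
      ((hf.pdy.mul hg.pdy).add (hf.pdy.mul hg.pdy))
      (l2sq_iterate_Aop_add_le k (hf.pdy.pdy.mul hg) (hf.mul hg.pdy.pdy)
        (ih _ _ M N hf.pdy.pdy hg hM.2.2.2.2 hN₀) (ih _ _ M N hf hg.pdy.pdy hM₀ hN.2.2.2.2))
      (l2sq_iterate_Aop_add_le k (hf.pdy.mul hg.pdy) (hf.pdy.mul hg.pdy)
        (ih _ _ M N hf.pdy hg.pdy hM₂ hN₂) (ih _ _ M N hf.pdy hg.pdy hM₂ hN₂))
    have sx := ((hf.pdx.pdx.mul hg).add (hf.mul hg.pdx.pdx)).add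
      ((hf.pdx.mul hg.pdx).add (hf.pdx.mul hg.pdx))
    have sy := ((hf.pdy.pdy.mul hg).add (hf.mul hg.pdy.pdy)).add
      ((hf.pdy.mul hg.pdy).add (hf.pdy.mul hg.pdy))
    have exy := l2sq_iterate_Aop_add_le k sx sy ex ey
    rw [← l2sq_neg, ← iterate_Aop_neg] at exy
    rw [Function.iterate_succ_apply, Aop_mul hf hg]
    refine (l2sq_iterate_Aop_add_le k (hf.mul hg) (sx.add sy).neg e₀ exy).trans (le_of_eq ?_)
    ring

/-- Estimate for `‖A^{m−1}(∇v ⋅ ∇w)‖`. -/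
theorem stmt_10 (m : ℕ) (hm : 1 ≤ m) :
    ∃ c > 0, ∀ v w : ℝ × ℝ → ℝ, SmoothPeriodic v → SmoothPeriodic w →
      l2norm (Aop^[m - 1] (gradDot v w)) ≤ c * l2norm (Aop^[m] v) * l2norm (Aop^[m] w) := by
  obtain ⟨k, rfl⟩ : ∃ k, m = k + 1 := ⟨m - 1, by omega⟩
  obtain ⟨C, hC, h⟩ := exists_l2sq_iterate_Aop_mul_le k
  refine ⟨√(4 * C), by positivity, fun v w hv hw => ?_⟩
  have hM := SobolevBound.of_iterate_Aop (k + 1) hv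
  have hN := SobolevBound.of_iterate_Aop (k + 1) hw
  have e := l2sq_iterate_Aop_add_le k (hv.pdx.mul hw.pdx) (hv.pdy.mul hw.pdy)
    (h _ _ _ _ hv.pdx hw.pdx hM.2.1 hN.2.1) (h _ _ _ _ hv.pdy hw.pdy hM.2.2 hN.2.2)
  rw [l2norm_eq_sqrt, l2norm_eq_sqrt, l2norm_eq_sqrt, ← Real.sqrt_mul (by positivity),
    ← Real.sqrt_mul (mul_nonneg (by positivity) (l2sq_nonneg _))]
  refine Real.sqrt_le_sqrt (e.trans (le_of_eq ?_))
  ring
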